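/- Let (X, ν) and (Y, μ) be subnumbered sets equipped with Lacombe bases (ℬ₁, β₁) and (ℬ₂, β₂), each such that every non-empty basic open set contains a computable point (so each basis is also a Spreen basis with equality as formal inclusion). Let f : X → Y be a (ν,μ)-computable function that is effectively continuous with respect to the Lacombe topologies. Then f is also effectively continuous with respect to the Spreen topologies generated by (ℬ₁, β₁, =) and (ℬ₂, β₂, =), computed by a realizer that respects the (extended) formal inclusion relations. -/

import Mathlib

namespace T1

/-- `phi e` : the `e`-th partial computable function `ℕ ⇀ ℕ`. -/
def phi (e : ℕ) : ℕ →. ℕ :=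
  Nat.Partrec.Code.eval (Denumerable.ofNat Nat.Partrec.Code e)

/-- `W e` : the `e`-th computably enumerable subset of `ℕ`. -/
def W (e : ℕ) : Set ℕ := (phi e).Dom

/-- A canonical numbering of the rationals. -/
def ratOfNat (k : ℕ) : ℚ := (Encodable.decode (α := ℚ) k).getD 0

/-- `e` is a name of `A ⊆ X` as a `ν`-semi-decidable set (a `ν_SD,m`-name):
`phi e` halts on a `ν`-name exactly when the named point belongs to `A`. -/
def SemiDecName {X : Type*} (ν : ℕ →. X) (A : Set X) (e : ℕ) : Prop :=
  ∀ i x, x ∈ ν i → ((phi e i).Dom ↔ x ∈ A)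

/-- `f : X → Y` is `(ν,μ)`-computable. -/
def Computes {X Y : Type*} (ν : ℕ →. X) (μ : ℕ →. Y) (f : X → Y) : Prop :=
  ∃ F : ℕ →. ℕ, Nat.Partrec F ∧ ∀ n x, x ∈ ν n → ∃ m ∈ F n, f x ∈ μ m

/-- `r` is a formal inclusion relation for the naming relation `β` of a family of
subsets of `X`: reflexive (on names), transitive, and implying actual inclusion. -/
structure IsFormalIncl {X : Type*} (β : ℕ → Set X → Prop) (r : ℕ → ℕ → Prop) : Prop where
  refl : ∀ n A, β n A → r n n
  trans : ∀ a b c, r a b → r b c → r a c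
  mono : ∀ n m A B, r n m → β n A → β m B → A ⊆ B

/-- Extension of a formal inclusion relation: a name vs. a sequence of names. -/
def SeqIncl (r : ℕ → ℕ → Prop) (b : ℕ) (s : ℕ → ℕ) : Prop := ∃ k, r b (s k)

/-- Extension of a formal inclusion relation: sequence vs. sequence. -/
def SeqIncl₂ (r : ℕ → ℕ → Prop) (s t : ℕ → ℕ) : Prop := ∀ p, SeqIncl r (s p) t

/-- The equivalence induced by the extended formal inclusion on sequences. -/
def SeqEquiv (r : ℕ → ℕ → Prop) (s t : ℕ → ℕ) : Prop := SeqIncl₂ r s t ∧ SeqIncl₂ r t s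

/-- A Type 1 computable topological space `(X, ν, T, τ, r)`, where `τ` is a
(single-valued) naming relation for open sets and `r` a formal inclusion relation. -/
structure IsCTS {X : Type*} (ν : ℕ →. X) (T : TopologicalSpace X)
    (τ : ℕ → Set X → Prop) (r : ℕ → ℕ → Prop) : Prop where
  single : ∀ n A B, τ n A → τ n B → A = B
  formal : IsFormalIncl τ r
  isOpen : ∀ n A, τ n A → T.IsOpen A
  generates : T = TopologicalSpace.generateFrom {A | ∃ n, τ n A}
  empty : ∃ n, τ n (∅ : Set X)
  univ : ∃ n, τ n (Set.univ : Set X)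
  malcev : ∃ F : ℕ →. ℕ, Nat.Partrec F ∧ ∀ n A, τ n A → ∃ e ∈ F n, SemiDecName ν A e
  union : ∃ U : ℕ →. ℕ, Nat.Partrec U ∧
    (∀ c (s : ℕ → ℕ) (A : ℕ → Set X), (∀ k, s k ∈ phi c k) → (∀ k, τ (s k) (A k)) →
      ∃ u ∈ U c, τ u (⋃ k, A k) ∧ ∀ k, r (s k) u) ∧
    (∀ c (s : ℕ → ℕ) (A : ℕ → Set X) c' (s' : ℕ → ℕ) (A' : ℕ → Set X),
      (∀ k, s k ∈ phi c k) → (∀ k, τ (s k) (A k)) →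
      (∀ k, s' k ∈ phi c' k) → (∀ k, τ (s' k) (A' k)) →
      (∀ p, SeqIncl r (s p) s') →
      ∀ u ∈ U c, ∀ u' ∈ U c', r u u')
  inter : ∃ I : ℕ →. ℕ, Nat.Partrec I ∧
    (∀ n₁ n₂ A₁ A₂, τ n₁ A₁ → τ n₂ A₂ → ∃ u ∈ I (Nat.pair n₁ n₂), τ u (A₁ ∩ A₂)) ∧
    (∀ n₁ n₂ A₁ A₂ n₁' n₂' A₁' A₂', τ n₁ A₁ → τ n₂ A₂ → τ n₁' A₁' → τ n₂' A₂' →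
      r n₁ n₁' → r n₂ n₂' →
      ∀ u ∈ I (Nat.pair n₁ n₂), ∀ u' ∈ I (Nat.pair n₁' n₂'), r u u')

/-- A Type 1 computable topological space with the actual inclusion relation as
formal inclusion (all monotonicity requirements are then automatic and omitted). -/
structure IsCTSIncl {X : Type*} (ν : ℕ →. X) (T : TopologicalSpace X)
    (τ : ℕ → Set X → Prop) : Prop where
  single : ∀ n A B, τ n A → τ n B → A = B
  isOpen : ∀ n A, τ n A → T.IsOpen A
  generates : T = TopologicalSpace.generateFrom {A | ∃ n, τ n A}
  empty : ∃ n, τ n (∅ : Set X)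
  univ : ∃ n, τ n (Set.univ : Set X)
  malcev : ∃ F : ℕ →. ℕ, Nat.Partrec F ∧ ∀ n A, τ n A → ∃ e ∈ F n, SemiDecName ν A e
  union : ∃ U : ℕ →. ℕ, Nat.Partrec U ∧
    ∀ c (s : ℕ → ℕ) (A : ℕ → Set X), (∀ k, s k ∈ phi c k) → (∀ k, τ (s k) (A k)) →
      ∃ u ∈ U c, τ u (⋃ k, A k)
  inter : ∃ I : ℕ →. ℕ, Nat.Partrec I ∧
    ∀ n₁ n₂ A₁ A₂, τ n₁ A₁ → τ n₂ A₂ → ∃ u ∈ I (Nat.pair n₁ n₂), τ u (A₁ ∩ A₂)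

/-- A Nogina basis for `(X, ν)` (with `ν` intended to be a numbering, i.e. onto). -/
structure IsNoginaBasis {X : Type*} (ν : ℕ →. X) (β : ℕ → Set X → Prop) : Prop where
  single : ∀ b B B', β b B → β b B' → B = B'
  semidec : ∃ F : ℕ →. ℕ, Nat.Partrec F ∧ ∀ b B, β b B → ∃ e ∈ F b, SemiDecName ν B e
  point : ∃ G : ℕ →. ℕ, Nat.Partrec G ∧
    ∀ n x, x ∈ ν n → ∃ b ∈ G n, ∃ B, β b B ∧ x ∈ B
  inter : ∃ H : ℕ →. ℕ, Nat.Partrec H ∧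
    ∀ b₁ b₂ B₁ B₂ n x, β b₁ B₁ → β b₂ B₂ → x ∈ ν n → x ∈ B₁ → x ∈ B₂ →
      ∃ b₃ ∈ H (Nat.pair (Nat.pair b₁ b₂) n), ∃ B₃, β b₃ B₃ ∧ x ∈ B₃ ∧ B₃ ⊆ B₁ ∩ B₂

/-- `p = ⟨e₁, e₂⟩` is a name of the open set `O` for the Nogina topology of the
basis `β`: `e₁` witnesses semi-decidability of `O` and `e₂` computes, from a
`ν`-name of a point of `O`, a basic set containing the point and contained in `O`. -/
def NoginaName {X : Type*} (ν : ℕ →. X) (β : ℕ → Set X → Prop) (p : ℕ) (O : Set X) : Prop :=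
  SemiDecName ν O p.unpair.1 ∧
  ∀ n x, x ∈ ν n → x ∈ O → ∃ b ∈ phi p.unpair.2 n, ∃ B, β b B ∧ x ∈ B ∧ B ⊆ O

/-- `i` is a name of `O` as a Lacombe set: `W i ⊆ dom β` and `O` is the union of
the basic sets named by elements of `W i`. -/
def LacombeName {X : Type*} (β : ℕ → Set X → Prop) (i : ℕ) (O : Set X) : Prop :=
  (∀ k ∈ W i, ∃ B, β k B) ∧ O = ⋃ k ∈ W i, ⋃ B, ⋃ (_ : β k B), B

/-- A Lacombe basis for `(X, ν)`. -/
structure IsLacombeBasis {X : Type*} (ν : ℕ →. X) (β : ℕ → Set X → Prop) : Prop where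
  single : ∀ b B B', β b B → β b B' → B = B'
  semidec : ∃ F : ℕ →. ℕ, Nat.Partrec F ∧ ∀ b B, β b B → ∃ e ∈ F b, SemiDecName ν B e
  point : ∀ x : X, ∃ b B, β b B ∧ x ∈ B
  cover : ∃ i, LacombeName β i (Set.univ : Set X)
  inter : ∃ H : ℕ →. ℕ, Nat.Partrec H ∧ ∀ b₁ b₂ B₁ B₂, β b₁ B₁ → β b₂ B₂ →
    ∃ i ∈ H (Nat.pair b₁ b₂), LacombeName β i (B₁ ∩ B₂)

/-- A Spreen basis for `(X, ν)`, with formal inclusion relation `r`.  Computable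
functions with values in `dom(β)^ℕ` are represented by partial computable
functions producing the `k`-th term of the sequence from the pair `⟨input, k⟩`. -/
structure IsSpreenBasis {X : Type*} (ν : ℕ →. X) (β : ℕ → Set X → Prop)
    (r : ℕ → ℕ → Prop) : Prop where
  single : ∀ b B B', β b B → β b B' → B = B'
  formal : IsFormalIncl β r
  semidec : ∃ F : ℕ →. ℕ, Nat.Partrec F ∧ ∀ b B, β b B → ∃ e ∈ F b, SemiDecName ν B e
  dense : ∀ b B, β b B → B.Nonempty → ∃ n x, x ∈ ν n ∧ x ∈ B
  G1 : ∃ g : ℕ →. ℕ, Nat.Partrec g ∧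
    (∀ n x, x ∈ ν n → ∃ s : ℕ → ℕ, (∀ k, s k ∈ g (Nat.pair n k)) ∧
      ∀ k, ∃ B, β (s k) B ∧ x ∈ B) ∧
    (∀ n m x (s t : ℕ → ℕ), x ∈ ν n → x ∈ ν m →
      (∀ k, s k ∈ g (Nat.pair n k)) → (∀ k, t k ∈ g (Nat.pair m k)) → SeqEquiv r s t) ∧
    (∀ x : X, ∃ b B, β b B ∧ x ∈ B ∧
      ∀ n y, y ∈ ν n → y ∈ B → ∀ s : ℕ → ℕ, (∀ k, s k ∈ g (Nat.pair n k)) → SeqIncl r b s)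
  G2 : ∃ g : ℕ →. ℕ, Nat.Partrec g ∧
    (∀ n x b₁ b₂ B₁ B₂, x ∈ ν n → β b₁ B₁ → β b₂ B₂ → x ∈ B₁ → x ∈ B₂ →
      ∃ s : ℕ → ℕ, (∀ k, s k ∈ g (Nat.pair (Nat.pair n (Nat.pair b₁ b₂)) k)) ∧
        ∀ k, ∃ B, β (s k) B ∧ x ∈ B ∧ B ⊆ B₁ ∩ B₂) ∧
    (∀ n m x b₁ b₂ b₁' b₂' (s t : ℕ → ℕ), x ∈ ν n → x ∈ ν m → r b₁ b₁' → r b₂ b₂' →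
      (∀ k, s k ∈ g (Nat.pair (Nat.pair n (Nat.pair b₁ b₂)) k)) →
      (∀ k, t k ∈ g (Nat.pair (Nat.pair m (Nat.pair b₁' b₂')) k)) → SeqIncl₂ r s t) ∧
    (∀ b₁ b₂ B₁ B₂, β b₁ B₁ → β b₂ B₂ → ∀ x, x ∈ B₁ → x ∈ B₂ →
      ∃ b₃ B₃, β b₃ B₃ ∧ x ∈ B₃ ∧
        ∀ m y, y ∈ ν m → y ∈ B₃ → ∀ s : ℕ → ℕ,
          (∀ k, s k ∈ g (Nat.pair (Nat.pair m (Nat.pair b₁ b₂)) k)) → SeqIncl r b₃ s)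

/-- `p = ⟨n, m⟩` is a name of the open set `O` for the Spreen topology of the
Spreen basis `(β, r)`. -/
def SpreenName {X : Type*} (ν : ℕ →. X) (β : ℕ → Set X → Prop) (r : ℕ → ℕ → Prop)
    (p : ℕ) (O : Set X) : Prop :=
  SemiDecName ν O p.unpair.1 ∧
  (∀ n x, x ∈ ν n → x ∈ O → ∃ s : ℕ → ℕ,
      (∀ k, s k ∈ phi p.unpair.2 (Nat.pair n k)) ∧
      ∀ k, ∃ B, β (s k) B ∧ x ∈ B ∧ B ⊆ O) ∧
  (∀ n m x (s t : ℕ → ℕ), x ∈ ν n → x ∈ ν m → x ∈ O →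
      (∀ k, s k ∈ phi p.unpair.2 (Nat.pair n k)) →
      (∀ k, t k ∈ phi p.unpair.2 (Nat.pair m k)) → SeqEquiv r s t) ∧
  (∀ x, x ∈ O → ∃ b B, β b B ∧ x ∈ B ∧
      ∀ n y, y ∈ ν n → y ∈ B → ∀ s : ℕ → ℕ,
        (∀ k, s k ∈ phi p.unpair.2 (Nat.pair n k)) → SeqIncl r b s)

/-- The extension of the formal inclusion relation `r` to names of Spreen open sets. -/
def SpreenTauIncl {X : Type*} (ν : ℕ →. X) (r : ℕ → ℕ → Prop) (p q : ℕ) : Prop :=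
  ∀ n ∈ ν.Dom, (phi p.unpair.1 n).Dom →
    (phi q.unpair.1 n).Dom ∧
    ∀ s t : ℕ → ℕ, (∀ k, s k ∈ phi p.unpair.2 (Nat.pair n k)) →
      (∀ k, t k ∈ phi q.unpair.2 (Nat.pair n k)) → SeqIncl₂ r s t

/-- A partial computable translation of Spreen names of open sets for the basis
`(β₁, r₁)` into Spreen names for the basis `(β₂, r₂)`, increasing with respect to
the extended formal inclusion relations. -/
def SpreenTopTrans {X : Type*} (ν : ℕ →. X) (β₁ : ℕ → Set X → Prop) (r₁ : ℕ → ℕ → Prop)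
    (β₂ : ℕ → Set X → Prop) (r₂ : ℕ → ℕ → Prop) : Prop :=
  ∃ h : ℕ →. ℕ, Nat.Partrec h ∧
    (∀ p O, SpreenName ν β₁ r₁ p O → ∃ q ∈ h p, SpreenName ν β₂ r₂ q O) ∧
    (∀ p p' O O', SpreenName ν β₁ r₁ p O → SpreenName ν β₁ r₁ p' O' →
      SpreenTauIncl ν r₁ p p' → ∀ q ∈ h p, ∀ q' ∈ h p', SpreenTauIncl ν r₂ q q')

/-- Effective continuity between computable topological spaces, with the actual
inclusion relations as formal inclusions. -/
def EffContinuous {X Y : Type*} (T₁ : TopologicalSpace X) (T₂ : TopologicalSpace Y)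
    (τ₁ : ℕ → Set X → Prop) (τ₂ : ℕ → Set Y → Prop) (f : X → Y) : Prop :=
  (@Continuous X Y T₁ T₂ f) ∧
  ∃ h : ℕ →. ℕ, Nat.Partrec h ∧ ∀ n O, τ₂ n O → ∃ m ∈ h n, τ₁ m (f ⁻¹' O)

/-- Effective continuity between computable topological spaces with formal
inclusion relations `r₁`, `r₂` on names of open sets. -/
def EffContinuousF {X Y : Type*} (T₁ : TopologicalSpace X) (T₂ : TopologicalSpace Y)
    (τ₁ : ℕ → Set X → Prop) (τ₂ : ℕ → Set Y → Prop)
    (r₁ r₂ : ℕ → ℕ → Prop) (f : X → Y) : Prop :=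
  (@Continuous X Y T₁ T₂ f) ∧
  ∃ h : ℕ →. ℕ, Nat.Partrec h ∧
    (∀ n O, τ₂ n O → ∃ m ∈ h n, τ₁ m (f ⁻¹' O)) ∧
    (∀ n₁ n₂ O₁ O₂, τ₂ n₁ O₁ → τ₂ n₂ O₂ → r₂ n₁ n₂ →
      ∀ m₁ ∈ h n₁, ∀ m₂ ∈ h n₂, r₁ m₁ m₂)

/-- `e` is a Cauchy name (`c_ℝ`-name) of the real number `x`. -/
def CRealName (e : ℕ) (x : ℝ) : Prop :=
  ∀ n : ℕ, ∃ m ∈ phi e n, |((ratOfNat m : ℚ) : ℝ) - x| < (2 : ℝ) ^ (-(n : ℤ))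

/-- `e` is a left (lower) name (`c_↗`-name) of the real number `x`: it computes a
nondecreasing sequence of rationals below `x` converging to `x`. -/
def LRealName (e : ℕ) (x : ℝ) : Prop :=
  ∃ s : ℕ → ℕ, (∀ n, s n ∈ phi e n) ∧
    (Monotone fun n => ratOfNat (s n)) ∧
    (∀ n, ((ratOfNat (s n) : ℚ) : ℝ) < x) ∧
    Filter.Tendsto (fun n => ((ratOfNat (s n) : ℚ) : ℝ)) Filter.atTop (nhds x)

/-- `(X, ν, d)` is a (non-necessarily effectively separable) computable metric
space: the computable points are dense and the metric is `(ν×ν, c_ℝ)`-computable. -/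
structure IsCMS {X : Type*} [MetricSpace X] (ν : ℕ →. X) : Prop where
  dense : Dense {x : X | ∃ n, x ∈ ν n}
  dist_comp : ∃ F : ℕ →. ℕ, Nat.Partrec F ∧
    ∀ n m x y, x ∈ ν n → y ∈ ν m → ∃ e ∈ F (Nat.pair n m), CRealName e (dist x y)

/-- The natural numbering of the open balls of a computable metric space, centered
at computable points with computable radii: `⟨n, m⟩` names `B(ν n, c_ℝ m)`. -/
def ballName {X : Type*} [MetricSpace X] (ν : ℕ →. X) (p : ℕ) (B : Set X) : Prop :=
  ∃ x r, x ∈ ν p.unpair.1 ∧ CRealName p.unpair.2 r ∧ B = Metric.ball x r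

/-- The natural formal inclusion relation on names of balls:
`(x, r₁) ⊆̊ (y, r₂)` iff `d(x, y) + r₁ ≤ r₂`. -/
def ballIncl {X : Type*} [MetricSpace X] (ν : ℕ →. X) (p q : ℕ) : Prop :=
  ∃ x y r s, x ∈ ν p.unpair.1 ∧ y ∈ ν q.unpair.1 ∧
    CRealName p.unpair.2 r ∧ CRealName q.unpair.2 s ∧ dist x y + r ≤ s

/-- `f` is effectively metric continuous: from a name of a point `x` and a name of
`ε > 0` one can compute a name of some `η > 0` witnessing continuity at `x`. -/
def EffMetricContinuous {X Y : Type*} [MetricSpace X] [MetricSpace Y]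
    (ν : ℕ →. X) (f : X → Y) : Prop :=
  ∃ H : ℕ →. ℕ, Nat.Partrec H ∧
    ∀ n x e ε, x ∈ ν n → CRealName e ε → (0:ℝ) < ε →
      ∃ m ∈ H (Nat.pair n e), ∃ η : ℝ, CRealName m η ∧ 0 < η ∧
        ∀ y : X, dist x y < η → dist (f x) (f y) < ε

/-- `(X, ν, d)` admits an algorithm of passage to the limit. -/
def HasLimitAlg {X : Type*} [MetricSpace X] (ν : ℕ →. X) : Prop :=
  ∃ L : ℕ →. ℕ, Nat.Partrec L ∧
    ∀ c (s : ℕ → ℕ) (xs : ℕ → X) (x : X),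
      (∀ k, s k ∈ phi c k) → (∀ k, xs k ∈ ν (s k)) →
      (∀ k m, k < m → dist (xs k) (xs m) < (2 : ℝ) ^ (-(k : ℤ))) →
      Filter.Tendsto xs Filter.atTop (nhds x) →
      ∃ p ∈ L c, x ∈ ν p


open Nat.Partrec (Code) in
theorem partrec₂_phi : Partrec₂ phi :=
  Code.eval_part.comp ((Computable.ofNat Code).comp Computable.fst) Computable.snd

open Nat.Partrec (Code) in
/-- The s-m-n theorem for the numbering `phi`. -/
theorem exists_computable_phi_eq {q : ℕ → ℕ →. ℕ} (hq : Partrec₂ q) :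
    ∃ S : ℕ → ℕ, Computable S ∧ ∀ p n, phi (S p) n = q p n := by
  have hq' : Nat.Partrec fun a => q a.unpair.1 a.unpair.2 :=
    Partrec.nat_iff.1 (hq.comp (Computable.fst.comp Computable.unpair)
      (Computable.snd.comp Computable.unpair))
  obtain ⟨c, hc⟩ := Code.exists_code.1 hq'
  refine ⟨fun p => Encodable.encode (Code.curry c p),
    Computable.encode.comp
      (Code.primrec₂_curry.to_comp.comp (Computable.const c) Computable.id), fun p n => ?_⟩
  simp [phi, Code.eval_curry, hc]

theorem exists_computable_W_eq_singleton :
    ∃ S : ℕ → ℕ, Computable S ∧ ∀ b, W (S b) = {b} := by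
  have hq : Partrec₂ fun b n : ℕ => bif decide (n = b) then Part.some 0 else (Part.none : Part ℕ) :=
    Partrec.cond (Primrec.eq.comp Primrec.snd Primrec.fst).decide.to_comp
      (Computable.const 0).partrec Partrec.none
  obtain ⟨S, hS, hSq⟩ := exists_computable_phi_eq hq
  refine ⟨S, hS, fun b => Set.ext fun n => ?_⟩
  change (phi (S b) n).Dom ↔ n = b
  rw [hSq]
  by_cases h : n = b <;> simp [h]

open Nat.Partrec (Code) in
theorem exists_computable_option_enumeration {ψ : ℕ → ℕ →. ℕ} (hψ : Partrec₂ ψ) :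
    ∃ D : ℕ → ℕ → Option ℕ, Computable₂ D ∧
      ∀ x u, (∃ w, u ∈ D x w) ↔ ∃ v, u ∈ ψ x v := by
  have hψ' : Nat.Partrec fun a => ψ a.unpair.1 a.unpair.2 :=
    Partrec.nat_iff.1 (hψ.comp (Computable.fst.comp Computable.unpair)
      (Computable.snd.comp Computable.unpair))
  obtain ⟨c, hc⟩ := Code.exists_code.1 hψ'
  have hc' : ∀ x v, c.eval (Nat.pair x v) = ψ x v := fun x v => by simp [hc]
  refine ⟨fun x w => Code.evaln w.unpair.2 c (Nat.pair x w.unpair.1), ?_, fun x u => ?_⟩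
  · exact (Code.primrec_evaln.comp
      (((Primrec.snd.comp (Primrec.unpair.comp Primrec.snd)).pair (Primrec.const c)).pair
        (Primrec₂.natPair.comp Primrec.fst
          (Primrec.fst.comp (Primrec.unpair.comp Primrec.snd))))).to_comp
  · simp only [← hc', Code.evaln_complete]
    constructor
    · rintro ⟨w, hw⟩
      exact ⟨w.unpair.1, w.unpair.2, hw⟩
    · rintro ⟨v, k, hk⟩
      exact ⟨Nat.pair v k, by simpa using hk⟩

/-- The non-empty sets among a uniformly computably enumerable family of sets are
uniformly enumerated by total functions. -/
theorem exists_total_enumeration {ψ : ℕ → ℕ →. ℕ} (hψ : Partrec₂ ψ) :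
    ∃ G : ℕ → ℕ →. ℕ, Partrec₂ G ∧ ∀ x,
      (∀ v u, u ∈ ψ x v → (∀ K, (G x K).Dom) ∧ ∃ K, u ∈ G x K) ∧
      ∀ K u, u ∈ G x K → ∃ v, u ∈ ψ x v := by
  obtain ⟨D, hD, hDψ⟩ := exists_computable_option_enumeration hψ
  refine ⟨fun x K => Nat.rfindOpt fun w => D x K <|> D x w, ?_, fun x => ⟨fun v u hu => ?_, ?_⟩⟩
  · refine Partrec.rfindOpt (f := fun (a : ℕ × ℕ) w => D a.1 a.2 <|> D a.1 w) ?_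
    exact Primrec.option_orElse.to_comp.comp
      (hD.comp (Computable.fst.comp Computable.fst) (Computable.snd.comp Computable.fst))
      (hD.comp (Computable.fst.comp Computable.fst) Computable.snd)
  · obtain ⟨w, hw⟩ := (hDψ x u).2 ⟨v, hu⟩
    have hdom : ∀ K, (Nat.rfindOpt fun w => D x K <|> D x w).Dom := fun K => by
      rw [Nat.rfindOpt_dom]
      refine ⟨w, ?_⟩
      rcases hK : D x K with _ | a
      · exact ⟨u, by simpa using hw⟩
      · exact ⟨a, by simp⟩
    refine ⟨hdom, w, ?_⟩
    obtain ⟨n, hn⟩ := Nat.rfindOpt_spec (Part.get_mem (hdom w))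
    have hw' : D x w = some u := hw
    have : u = (Nat.rfindOpt fun w' => D x w <|> D x w').get (hdom w) := by simpa [hw'] using hn
    rw [this]
    exact Part.get_mem _
  · intro K u hu
    obtain ⟨n, hn⟩ := Nat.rfindOpt_spec hu
    rw [← hDψ]
    rcases hK : D x K with _ | a
    · exact ⟨n, by simpa [hK] using hn⟩
    · exact ⟨K, by simpa [hK] using hn⟩

/-- `k` is enumerated by a set with an index in `g b`, and the algorithm with code given by
`sd k` accepts `n`. -/
def Accepts (g sd : ℕ →. ℕ) (n b k : ℕ) : Prop :=
  ∃ i ∈ g b, k ∈ W i ∧ ∃ e ∈ sd k, (phi e n).Dom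

/-- Uniformly in a code `p = ⟨e₁, e₂⟩`, one can precompose `e₁` with `F`, and replace the
sequence computed by `e₂` on input `F n` by an enumeration of all indices accepted along it. -/
theorem exists_pullback {F g sd : ℕ →. ℕ} (hF : Partrec F) (hg : Partrec g) (hsd : Partrec sd) :
    ∃ h : ℕ → ℕ, Computable h ∧ ∀ p n,
      (∀ m ∈ F n, phi (h p).unpair.1 n = phi p.unpair.1 m) ∧
      (∀ s : ℕ → ℕ, (∀ k, s k ∈ phi (h p).unpair.2 (Nat.pair n k)) →
        ∃ m ∈ F n, ∃ t : ℕ → ℕ, (∀ j, t j ∈ phi p.unpair.2 (Nat.pair m j)) ∧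
          ∀ k, (∃ l, s l = k) ↔ ∃ j, Accepts g sd n (t j) k) ∧
      (∀ m ∈ F n, ∀ t : ℕ → ℕ, (∀ j, t j ∈ phi p.unpair.2 (Nat.pair m j)) →
        (∃ j k, Accepts g sd n (t j) k) →
        ∃ s : ℕ → ℕ, ∀ k, s k ∈ phi (h p).unpair.2 (Nat.pair n k)) := by
  have u₁ : Computable fun a : ℕ => a.unpair.1 := Computable.fst.comp Computable.unpair
  have u₂ : Computable fun a : ℕ => a.unpair.2 := Computable.snd.comp Computable.unpair
  let term : ℕ → ℕ → ℕ →. ℕ := fun p n j =>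
    (F n).bind fun m => phi p.unpair.2 (Nat.pair m j)
  have hterm : Partrec fun a : (ℕ × ℕ) × ℕ => term a.1.1 a.1.2 a.2 :=
    (hF.comp (Computable.snd.comp Computable.fst)).bind
      (partrec₂_phi.comp
        (u₂.comp (Computable.fst.comp (Computable.fst.comp Computable.fst)))
        (Primrec₂.natPair.to_comp.comp Computable.snd
          (Computable.snd.comp Computable.fst))).to₂
  let ψ : ℕ → ℕ →. ℕ := fun x v =>
    (term x.unpair.1 x.unpair.2 v.unpair.1).bind fun b => (g b).bind fun i =>
      (phi i v.unpair.2).bind fun _ => (sd v.unpair.2).bind fun e =>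
        (phi e x.unpair.2).bind fun _ => Part.some v.unpair.2
  have hψ : Partrec₂ ψ := by
    refine Partrec.bind (hterm.comp
      (((u₁.comp Computable.fst).pair (u₂.comp Computable.fst)).pair
        (u₁.comp Computable.snd))) ?_
    refine Partrec.bind (hg.comp Computable.snd) ?_
    refine Partrec.bind (partrec₂_phi.comp Computable.snd
      (u₂.comp (Computable.snd.comp (Computable.fst.comp Computable.fst)))) ?_
    refine Partrec.bind (hsd.comp (u₂.comp (Computable.snd.comp
      (Computable.fst.comp (Computable.fst.comp Computable.fst))))) ?_
    refine Partrec.bind (partrec₂_phi.comp Computable.snd (u₂.comp (Computable.fst.comp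
      (Computable.fst.comp (Computable.fst.comp (Computable.fst.comp Computable.fst)))))) ?_
    exact (u₂.comp (Computable.snd.comp (Computable.fst.comp (Computable.fst.comp
      (Computable.fst.comp (Computable.fst.comp Computable.fst)))))).partrec
  have mem_ψ : ∀ p n u, (∃ v, u ∈ ψ (Nat.pair p n) v) ↔
      ∃ j, ∃ b ∈ term p n j, Accepts g sd n b u := by
    intro p n u
    simp only [ψ, Accepts, Part.mem_bind_iff, Nat.unpair_pair, Part.mem_some_iff]
    constructor
    · rintro ⟨v, b, hb, i, hi, z, hz, e, he, z', hz', rfl⟩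
      exact ⟨_, b, hb, i, hi, Part.dom_iff_mem.2 ⟨z, hz⟩, e, he, Part.dom_iff_mem.2 ⟨z', hz'⟩⟩
    · rintro ⟨j, b, hb, i, hi, hz, e, he, hz'⟩
      obtain ⟨z, hz⟩ := Part.dom_iff_mem.1 hz
      obtain ⟨z', hz'⟩ := Part.dom_iff_mem.1 hz'
      refine ⟨Nat.pair j u, b, ?_, i, hi, z, ?_, e, ?_, z', hz', ?_⟩ <;> simp_all
  obtain ⟨G, hG, hGψ⟩ := exists_total_enumeration hψ
  have hq₁ : Partrec₂ fun p n : ℕ => (F n).bind (phi p.unpair.1) :=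
    Partrec.bind (hF.comp Computable.snd)
      (partrec₂_phi.comp (u₁.comp (Computable.fst.comp Computable.fst)) Computable.snd).to₂
  have hq₂ : Partrec₂ fun p a : ℕ => (term p a.unpair.1 a.unpair.2).bind fun _ =>
      G (Nat.pair p a.unpair.1) a.unpair.2 :=
    Partrec.bind (hterm.comp ((Computable.fst.pair (u₁.comp Computable.snd)).pair
        (u₂.comp Computable.snd)))
      (hG.comp
        (Primrec₂.natPair.to_comp.comp (Computable.fst.comp Computable.fst)
          (u₁.comp (Computable.snd.comp Computable.fst)))
        (u₂.comp (Computable.snd.comp Computable.fst))).to₂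
  obtain ⟨S₁, hS₁, hS₁q⟩ := exists_computable_phi_eq hq₁
  obtain ⟨S₂, hS₂, hS₂q⟩ := exists_computable_phi_eq hq₂
  refine ⟨fun p => Nat.pair (S₁ p) (S₂ p), Primrec₂.natPair.to_comp.comp hS₁ hS₂,
    fun p n => ⟨fun m hm => ?_, fun s hs => ?_, fun m hm t ht hacc => ?_⟩⟩
  · rw [Nat.unpair_pair, hS₁q, Part.eq_some_iff.2 hm]
    exact Part.bind_some _ _
  · simp only [Nat.unpair_pair, hS₂q, Part.mem_bind_iff] at hs
    choose t ht hsG using hs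
    simp only [term, Part.mem_bind_iff] at ht
    obtain ⟨m, hm, -⟩ := ht 0
    have ht' : ∀ j, t j ∈ phi p.unpair.2 (Nat.pair m j) := fun j => by
      obtain ⟨m', hm', h⟩ := ht j
      rwa [Part.mem_unique hm hm']
    refine ⟨m, hm, t, ht', fun k => ⟨?_, ?_⟩⟩
    · rintro ⟨l, rfl⟩
      obtain ⟨j, b, hb, hacc⟩ := (mem_ψ p n _).1 ((hGψ _).2 l _ (hsG l))
      obtain ⟨m', hm', h⟩ := Part.mem_bind_iff.1 hb
      obtain rfl := Part.mem_unique hm hm'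
      obtain rfl := Part.mem_unique (ht' j) h
      exact ⟨j, hacc⟩
    · rintro ⟨j, hacc⟩
      obtain ⟨v, hv⟩ := (mem_ψ p n k).2 ⟨j, t j, Part.mem_bind_iff.2 ⟨m, hm, ht' j⟩, hacc⟩
      obtain ⟨-, l, hl⟩ := (hGψ _).1 v k hv
      exact ⟨l, Part.mem_unique (hsG l) hl⟩
  · obtain ⟨j, k, hacc⟩ := hacc
    obtain ⟨v, hv⟩ := (mem_ψ p n k).2 ⟨j, t j, Part.mem_bind_iff.2 ⟨m, hm, ht j⟩, hacc⟩
    have hdom := ((hGψ _).1 v k hv).1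
    refine ⟨fun l => (G (Nat.pair p n) l).get (hdom l), fun l => ?_⟩
    simp only [Nat.unpair_pair, hS₂q, Part.mem_bind_iff]
    exact ⟨t l, Part.mem_bind_iff.2 ⟨m, hm, ht l⟩, Part.get_mem _⟩

theorem LacombeName.mem_iff {X : Type*} {β : ℕ → Set X → Prop} {i : ℕ} {O : Set X}
    (h : LacombeName β i O) (x : X) : x ∈ O ↔ ∃ k ∈ W i, ∃ B, β k B ∧ x ∈ B := by
  rw [h.2]
  simp

theorem lacombeName_of_W_eq_singleton {X : Type*} {β : ℕ → Set X → Prop}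
    (single : ∀ b B B', β b B → β b B' → B = B') {i b : ℕ} (hi : W i = {b}) {B : Set X}
    (hB : β b B) : LacombeName β i B := by
  refine ⟨fun k hk => ⟨B, by simp_all⟩, Set.ext fun x => ?_⟩
  simp only [hi, Set.mem_singleton_iff, Set.iUnion_iUnion_eq_left, Set.mem_iUnion, exists_prop]
  exact ⟨fun hx => ⟨B, hB, hx⟩, fun ⟨B', hB', hx⟩ => single b B' B hB' hB ▸ hx⟩

/-- On names, acceptance decides membership in the basic set `k` of the Lacombe preimage. -/
theorem accepts_iff {X Y : Type*} {ν : ℕ →. X} {β₁ : ℕ → Set X → Prop}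
    {β₂ : ℕ → Set Y → Prop} {f : X → Y} {g sd : ℕ →. ℕ}
    (hsd : ∀ b B, β₁ b B → ∃ e ∈ sd b, SemiDecName ν B e)
    (hg : ∀ b B, β₂ b B → ∃ i ∈ g b, LacombeName β₁ i (f ⁻¹' B))
    {b : ℕ} {B : Set Y} (hB : β₂ b B) {n : ℕ} {x : X} (hx : x ∈ ν n) (k : ℕ) :
    Accepts g sd n b k ↔ ∃ A, β₁ k A ∧ x ∈ A ∧ A ⊆ f ⁻¹' B ∧ ∃ i ∈ g b, k ∈ W i := by
  obtain ⟨i, hi, hiB⟩ := hg b B hB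
  constructor
  · rintro ⟨i', hi', hk, e, he, hdom⟩
    obtain rfl := Part.mem_unique hi hi'
    obtain ⟨A, hA⟩ := hiB.1 k hk
    obtain ⟨e', he', hsemi⟩ := hsd k A hA
    obtain rfl := Part.mem_unique he he'
    exact ⟨A, hA, (hsemi n x hx).1 hdom, fun y hy => (hiB.mem_iff y).2 ⟨k, hk, A, hA, hy⟩,
      i, hi, hk⟩
  · rintro ⟨A, hA, hxA, -, i', hi', hk⟩
    obtain ⟨e, he, hsemi⟩ := hsd k A hA
    exact ⟨i', hi', hk, e, he, (hsemi n x hx).2 hxA⟩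

/-- Let `(X, ν)` and `(Y, μ)` carry Lacombe bases whose
non-empty basic sets contain computable points (so that they are also Spreen
bases with equality as formal inclusion). If a `(ν,μ)`-computable `f` is
effectively continuous for the Lacombe topologies, then it is also effectively
continuous for the Spreen topologies, by a realizer respecting the extended
formal inclusion relations. -/
theorem lacombe_effContinuous_implies_spreen_effContinuous {X Y : Type*}
    (ν : ℕ →. X) (μ : ℕ →. Y)
    (β₁ : ℕ → Set X → Prop) (h₁ : IsLacombeBasis ν β₁)
    (β₂ : ℕ → Set Y → Prop) (h₂ : IsLacombeBasis μ β₂)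
    (hd₁ : ∀ b B, β₁ b B → B.Nonempty → ∃ n x, x ∈ ν n ∧ x ∈ B)
    (hd₂ : ∀ b B, β₂ b B → B.Nonempty → ∃ n y, y ∈ μ n ∧ y ∈ B)
    (f : X → Y) (hf : Computes ν μ f)
    (hcont : EffContinuous (TopologicalSpace.generateFrom {B | ∃ b, β₁ b B})
      (TopologicalSpace.generateFrom {B | ∃ b, β₂ b B})
      (LacombeName β₁) (LacombeName β₂) f) :
    EffContinuousF (TopologicalSpace.generateFrom {B | ∃ b, β₁ b B})
      (TopologicalSpace.generateFrom {B | ∃ b, β₂ b B})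
      (SpreenName ν β₁ (fun a b => a = b)) (SpreenName μ β₂ (fun a b => a = b))
      (SpreenTauIncl ν (fun a b => a = b)) (SpreenTauIncl μ (fun a b => a = b)) f := by
  obtain ⟨F, hF, hFf⟩ := hf
  obtain ⟨hcts, g₀, hg₀, hg₀'⟩ := hcont
  obtain ⟨sd, hsd, hsd'⟩ := h₁.semidec
  obtain ⟨S, hS, hSW⟩ := exists_computable_W_eq_singleton
  have hg : ∀ b B, β₂ b B → ∃ i ∈ g₀ (S b), LacombeName β₁ i (f ⁻¹' B) := fun b B hB =>
    hg₀' _ _ (lacombeName_of_W_eq_singleton h₂.single (hSW b) hB)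
  have hacc {b : ℕ} {B : Set Y} (hB : β₂ b B) {n : ℕ} {x : X} (hx : x ∈ ν n) (k : ℕ) :=
    accepts_iff (g := fun b => g₀ (S b)) hsd' hg hB hx k
  obtain ⟨h, hh, hspec⟩ := exists_pullback (Partrec.nat_iff.2 hF)
    ((Partrec.nat_iff.2 hg₀).comp hS) (Partrec.nat_iff.2 hsd)
  have hF_eq {n m : ℕ} {x : X} (hx : x ∈ ν n) (hm : m ∈ F n) : f x ∈ μ m := by
    obtain ⟨m', hm', hfx⟩ := hFf n x hx
    rwa [Part.mem_unique hm hm']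
  refine ⟨hcts, h, Partrec.nat_iff.1 hh.partrec, fun p O hO => ⟨h p, Part.mem_some _, ?_⟩, ?_⟩
  · obtain ⟨hO₁, hO₂, hO₃, hO₄⟩ := hO
    have hterms {m : ℕ} {y : Y} (hy : y ∈ μ m) (hyO : y ∈ O) {t : ℕ → ℕ}
        (ht : ∀ j, t j ∈ phi p.unpair.2 (Nat.pair m j)) (j : ℕ) :
        ∃ B, β₂ (t j) B ∧ y ∈ B ∧ B ⊆ O := by
      obtain ⟨t', ht', htB⟩ := hO₂ m y hy hyO
      rw [Part.mem_unique (ht j) (ht' j)]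
      exact htB j
    refine ⟨fun n x hx => ?_, fun n x hx hxO => ?_, ?_, fun x hxO => ?_⟩
    · obtain ⟨m, hm, hfx⟩ := hFf n x hx
      rw [(hspec p n).1 m hm]
      exact hO₁ m _ hfx
    · obtain ⟨m, hm, hfx⟩ := hFf n x hx
      obtain ⟨t, ht, htB⟩ := hO₂ m _ hfx hxO
      obtain ⟨B, hB, hxB, -⟩ := htB 0
      obtain ⟨i, hi, hiB⟩ := hg _ B hB
      obtain ⟨k, hk, A, hA, hxA⟩ := (hiB.mem_iff x).1 hxB
      obtain ⟨s, hs⟩ := (hspec p n).2.2 m hm t ht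
        ⟨0, k, (hacc hB hx k).2 ⟨A, hA, hxA, fun y hy => (hiB.mem_iff y).2 ⟨k, hk, A, hA, hy⟩,
          i, hi, hk⟩⟩
      refine ⟨s, hs, fun l => ?_⟩
      obtain ⟨m', hm', t', ht', hst⟩ := (hspec p n).2.1 s hs
      obtain ⟨j, hj⟩ := (hst (s l)).1 ⟨l, rfl⟩
      obtain ⟨B', hB', -, hB'O⟩ := hterms (hF_eq hx hm') hxO ht' j
      obtain ⟨A', hA', hxA', hsub, -⟩ := (hacc hB' hx _).1 hj
      exact ⟨A', hA', hxA', hsub.trans (Set.preimage_mono hB'O)⟩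
    · suffices H : ∀ n m x (s t : ℕ → ℕ), x ∈ ν n → x ∈ ν m → x ∈ f ⁻¹' O →
          (∀ k, s k ∈ phi (h p).unpair.2 (Nat.pair n k)) →
          (∀ k, t k ∈ phi (h p).unpair.2 (Nat.pair m k)) →
          SeqIncl₂ (fun a b => a = b) s t from
        fun n m x s t hn hm hxO hs ht => ⟨H n m x s t hn hm hxO hs ht, H m n x t s hm hn hxO ht hs⟩
      intro n m x s t hn hm hxO hs ht l
      obtain ⟨n', hn', s', hs', hss⟩ := (hspec p n).2.1 s hs
      obtain ⟨m', hm', t', ht', htt⟩ := (hspec p m).2.1 t ht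
      obtain ⟨j, hj⟩ := (hss (s l)).1 ⟨l, rfl⟩
      obtain ⟨j', hj'⟩ := (hO₃ n' m' _ s' t' (hF_eq hn hn') (hF_eq hm hm') hxO hs' ht').1 j
      obtain ⟨B, hB, -⟩ := hterms (hF_eq hn hn') hxO hs' j
      obtain ⟨l', hl'⟩ := (htt (s l)).2 ⟨j', by
        rw [← hj']; exact (hacc hB hm _).2 ((hacc hB hn _).1 hj)⟩
      exact ⟨l', hl'.symm⟩
    · obtain ⟨b, B, hB, hxB, hbB⟩ := hO₄ (f x) hxO
      obtain ⟨i, hi, hiB⟩ := hg b B hB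
      obtain ⟨k, hk, A, hA, hxA⟩ := (hiB.mem_iff x).1 hxB
      have hAB : A ⊆ f ⁻¹' B := fun y hy => (hiB.mem_iff y).2 ⟨k, hk, A, hA, hy⟩
      refine ⟨k, A, hA, hxA, fun n y hy hyA s hs => ?_⟩
      obtain ⟨m, hm, t, ht, hst⟩ := (hspec p n).2.1 s hs
      obtain ⟨j, hj⟩ := hbB m (f y) (hF_eq hy hm) (hAB hyA) t ht
      obtain ⟨l, hl⟩ := (hst k).2 ⟨j, by
        rw [← hj]; exact (hacc hB hy k).2 ⟨A, hA, hyA, hAB, i, hi, hk⟩⟩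
      exact ⟨l, hl.symm⟩
  · intro p p' O O' _ _ hpp q hq q' hq' n hn hdom
    obtain rfl := Part.mem_some_iff.1 hq
    obtain rfl := Part.mem_some_iff.1 hq'
    obtain ⟨x, hx⟩ := Part.dom_iff_mem.1 hn
    obtain ⟨m, hm, hfx⟩ := hFf n x hx
    rw [(hspec p n).1 m hm] at hdom
    obtain ⟨hdom', hincl⟩ := hpp m (Part.dom_iff_mem.2 ⟨_, hfx⟩) hdom
    refine ⟨by rwa [(hspec p' n).1 m hm], fun s t hs ht l => ?_⟩
    obtain ⟨n', hn', s', hs', hss⟩ := (hspec p n).2.1 s hs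
    obtain ⟨m', hm', t', ht', htt⟩ := (hspec p' n).2.1 t ht
    obtain rfl := Part.mem_unique hm hn'
    obtain rfl := Part.mem_unique hm hm'
    obtain ⟨j, hj⟩ := (hss (s l)).1 ⟨l, rfl⟩
    obtain ⟨j', hj'⟩ := hincl s' t' hs' ht' j
    obtain ⟨l', hl'⟩ := (htt (s l)).2 ⟨j', by rw [← hj']; exact hj⟩
    exact ⟨l', hl'.symm⟩

end T1
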